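/- Let V be a 2-generated primitive axial algebra of Monster type (2β, β) over a field F of characteristic ≠ 2 (β ∉ {0, 1, 1/2}) with generating axes a₀, a₁. Then a₄ = a₋₂ − 2·Z(λ₁, λ₁ᶠ)·(a₋₁ − a₃) + (1/β)·[4·Z(λ₁, λ₁ᶠ)·(λ₁ − β) − (2λ₂ − β)]·(a₀ − a₂). -/

import Mathlib

/-- The `δ`-eigenspace of the adjoint action of `a` on `V`. -/
def eigSp (F : Type*) [Field F] {V : Type*} [NonUnitalNonAssocCommRing V]
    [Module F V] [SMulCommClass F V V] [IsScalarTower F V V]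
    (a : V) (δ : F) : Submodule F V where
  carrier := {v | a * v = δ • v}
  add_mem' := by
    intro x y hx hy
    simp only [Set.mem_setOf_eq] at *
    rw [mul_add, hx, hy, smul_add]
  zero_mem' := by
    simp
  smul_mem' := by
    intro c x hx
    simp only [Set.mem_setOf_eq] at *
    rw [mul_smul_comm, hx, smul_comm]

/-- `τ` is the Miyamoto involution associated with the axis `a`:  it is the identity on the
`1`-, `0`- and `α`-eigenspaces of `ad a` and `-1` on the `β`-eigenspace. -/
def IsMiyamoto (F : Type*) [Field F] {V : Type*} [NonUnitalNonAssocCommRing V]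
    [Module F V] [SMulCommClass F V V] [IsScalarTower F V V]
    (α β : F) (a : V) (τ : V ≃ₗ[F] V) : Prop :=
  (∀ v ∈ eigSp F a 1, τ v = v) ∧ (∀ v ∈ eigSp F a 0, τ v = v) ∧
    (∀ v ∈ eigSp F a α, τ v = v) ∧ (∀ v ∈ eigSp F a β, τ v = -v)

/-- `a` is a primitive axis of Monster type `(α, β)`:  `a` is idempotent, `V` decomposes as the
sum of the eigenspaces of `ad a` for the eigenvalues `1, 0, α, β`, the fusion law
M(α, β) holds, and the `1`-eigenspace is spanned by `a` (primitivity). -/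
structure IsAxis (F : Type*) [Field F] {V : Type*} [NonUnitalNonAssocCommRing V]
    [Module F V] [SMulCommClass F V V] [IsScalarTower F V V]
    (α β : F) (a : V) : Prop where
  idem : a * a = a
  semisimple : eigSp F a 1 ⊔ eigSp F a 0 ⊔ eigSp F a α ⊔ eigSp F a β = ⊤
  primitive : eigSp F a 1 = Submodule.span F {a}
  fusion11 : ∀ u ∈ eigSp F a 1, ∀ v ∈ eigSp F a 1, u * v ∈ eigSp F a 1
  fusion10 : ∀ u ∈ eigSp F a 1, ∀ v ∈ eigSp F a 0, u * v = 0
  fusion1a : ∀ u ∈ eigSp F a 1, ∀ v ∈ eigSp F a α, u * v ∈ eigSp F a α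
  fusion1b : ∀ u ∈ eigSp F a 1, ∀ v ∈ eigSp F a β, u * v ∈ eigSp F a β
  fusion00 : ∀ u ∈ eigSp F a 0, ∀ v ∈ eigSp F a 0, u * v ∈ eigSp F a 0
  fusion0a : ∀ u ∈ eigSp F a 0, ∀ v ∈ eigSp F a α, u * v ∈ eigSp F a α
  fusion0b : ∀ u ∈ eigSp F a 0, ∀ v ∈ eigSp F a β, u * v ∈ eigSp F a β
  fusionaa : ∀ u ∈ eigSp F a α, ∀ v ∈ eigSp F a α, u * v ∈ eigSp F a 1 ⊔ eigSp F a 0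
  fusionab : ∀ u ∈ eigSp F a α, ∀ v ∈ eigSp F a β, u * v ∈ eigSp F a β
  fusionbb : ∀ u ∈ eigSp F a β, ∀ v ∈ eigSp F a β,
    u * v ∈ eigSp F a 1 ⊔ eigSp F a 0 ⊔ eigSp F a α

/-- The sequence of axes `a i` (`i ∈ ℤ`) generated from `a₀`, `a₁` by the Miyamoto
involutions:  with `σ = τ₁ ∘ τ₀`, `a (2*i) = σ^i a₀` and `a (2*i+1) = σ^i a₁`. -/
noncomputable def aSeq {F : Type*} [Field F] {V : Type*} [NonUnitalNonAssocCommRing V]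
    [Module F V] [SMulCommClass F V V] [IsScalarTower F V V]
    (a₀ a₁ : V) (τ₀ τ₁ : V ≃ₗ[F] V) (i : ℤ) : V :=
  if i % 2 = 0 then ((τ₁ * τ₀) ^ (i / 2)) a₀ else ((τ₁ * τ₀) ^ ((i - 1) / 2)) a₁

/-- `s r n = a r * a (r+n) - β • (a r + a (r+n))`. -/
noncomputable def sSeq {F : Type*} [Field F] {V : Type*} [NonUnitalNonAssocCommRing V]
    [Module F V] [SMulCommClass F V V] [IsScalarTower F V V]
    (β : F) (a₀ a₁ : V) (τ₀ τ₁ : V ≃ₗ[F] V) (r n : ℤ) : V :=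
  aSeq a₀ a₁ τ₀ τ₁ r * aSeq a₀ a₁ τ₀ τ₁ (r + n)
    - β • (aSeq a₀ a₁ τ₀ τ₁ r + aSeq a₀ a₁ τ₀ τ₁ (r + n))

/-- The polynomial `Z(x, y) = (2/β) x + ((2β-1)/β²) y - (4β-1)/β`. -/
noncomputable def zPoly {F : Type*} [Field F] (β x y : F) : F :=
  2 / β * x + (2 * β - 1) / β ^ 2 * y - (4 * β - 1) / β

section MonsterType

variable {F : Type*} [Field F] {V : Type*} [NonUnitalNonAssocCommRing V]
  [Module F V] [SMulCommClass F V V] [IsScalarTower F V V] {α β : F} {a b : V}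

theorem mem_eigSp {δ : F} {v : V} : v ∈ eigSp F a δ ↔ a * v = δ • v := Iff.rfl

theorem IsAxis.exists_decomposition (ha : IsAxis F α β a) (x : V) :
    ∃ e ∈ eigSp F a 1, ∃ u ∈ eigSp F a 0, ∃ v ∈ eigSp F a α, ∃ w ∈ eigSp F a β,
      x = e + u + v + w := by
  have hx : x ∈ eigSp F a 1 ⊔ eigSp F a 0 ⊔ eigSp F a α ⊔ eigSp F a β := by
    rw [ha.semisimple]; trivial
  simp only [Submodule.mem_sup] at hx
  obtain ⟨_, ⟨_, ⟨e, he, u, hu, rfl⟩, v, hv, rfl⟩, w, hw, rfl⟩ := hx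
  exact ⟨e, he, u, hu, v, hv, w, hw, rfl⟩

theorem exists_eigenvectors_of_sub_mem_sup {x : V} {l : F}
    (h : x - l • a ∈ eigSp F a 0 ⊔ eigSp F a α ⊔ eigSp F a β) :
    ∃ u ∈ eigSp F a 0, ∃ v ∈ eigSp F a α, ∃ w ∈ eigSp F a β, x = l • a + u + v + w := by
  simp only [Submodule.mem_sup] at h
  obtain ⟨_, ⟨u, hu, v, hv, rfl⟩, w, hw, h⟩ := h
  exact ⟨u, hu, v, hv, w, hw, by rw [eq_sub_iff_add_eq] at h; rw [← h]; abel⟩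

theorem IsMiyamoto.apply_of_mem_even {τ : V ≃ₗ[F] V} (hτ : IsMiyamoto F α β a τ) {x : V}
    (hx : x ∈ eigSp F a 1 ⊔ eigSp F a 0 ⊔ eigSp F a α) : τ x = x := by
  simp only [Submodule.mem_sup] at hx
  obtain ⟨_, ⟨e, he, u, hu, rfl⟩, v, hv, rfl⟩ := hx
  rw [map_add, map_add, hτ.1 e he, hτ.2.1 u hu, hτ.2.2.1 v hv]

theorem IsMiyamoto.apply_decomposition {τ : V ≃ₗ[F] V} (hτ : IsMiyamoto F α β a τ)
    {e u v w : V} (he : e ∈ eigSp F a 1) (hu : u ∈ eigSp F a 0) (hv : v ∈ eigSp F a α)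
    (hw : w ∈ eigSp F a β) : τ (e + u + v + w) = e + u + v - w := by
  rw [map_add, map_add, map_add, hτ.1 e he, hτ.2.1 u hu, hτ.2.2.1 v hv, hτ.2.2.2 w hw,
    sub_eq_add_neg]

theorem IsAxis.miyamoto_apply_apply (ha : IsAxis F α β a) {τ : V ≃ₗ[F] V}
    (hτ : IsMiyamoto F α β a τ) (x : V) : τ (τ x) = x := by
  obtain ⟨e, he, u, hu, v, hv, w, hw, rfl⟩ := ha.exists_decomposition x
  rw [hτ.apply_decomposition he hu hv hw, sub_eq_add_neg,
    hτ.apply_decomposition he hu hv (neg_mem hw), sub_neg_eq_add]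

theorem IsAxis.miyamoto_apply_self (ha : IsAxis F α β a) {τ : V ≃ₗ[F] V}
    (hτ : IsMiyamoto F α β a τ) : τ a = a :=
  hτ.1 a (by rw [mem_eigSp, ha.idem, one_smul])

theorem IsAxis.miyamoto_map_mul (ha : IsAxis F α β a) {τ : V ≃ₗ[F] V}
    (hτ : IsMiyamoto F α β a τ) (x y : V) : τ (x * y) = τ x * τ y := by
  obtain ⟨e, he, u, hu, v, hv, w, hw, rfl⟩ := ha.exists_decomposition x
  obtain ⟨e', he', u', hu', v', hv', w', hw', rfl⟩ := ha.exists_decomposition y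
  rw [hτ.apply_decomposition he hu hv hw, hτ.apply_decomposition he' hu' hv' hw']
  simp only [add_mul, mul_add, sub_mul, mul_sub, map_add]
  rw [hτ.1 _ (ha.fusion11 e he e' he'), ha.fusion10 e he u' hu',
    hτ.2.2.1 _ (ha.fusion1a e he v' hv'), hτ.2.2.2 _ (ha.fusion1b e he w' hw'),
    mul_comm u e', ha.fusion10 e' he' u hu, hτ.2.1 _ (ha.fusion00 u hu u' hu'),
    hτ.2.2.1 _ (ha.fusion0a u hu v' hv'), hτ.2.2.2 _ (ha.fusion0b u hu w' hw'),
    mul_comm v e', hτ.2.2.1 _ (ha.fusion1a e' he' v hv),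
    mul_comm v u', hτ.2.2.1 _ (ha.fusion0a u' hu' v hv),
    hτ.apply_of_mem_even (Submodule.mem_sup_left (ha.fusionaa v hv v' hv')),
    hτ.2.2.2 _ (ha.fusionab v hv w' hw'),
    mul_comm w e', hτ.2.2.2 _ (ha.fusion1b e' he' w hw),
    mul_comm w u', hτ.2.2.2 _ (ha.fusion0b u' hu' w hw),
    mul_comm w v', hτ.2.2.2 _ (ha.fusionab v' hv' w hw),
    hτ.apply_of_mem_even (ha.fusionbb w hw w' hw'), map_zero]
  abel

/-- The product of an axis `a` with `a * b - β • (a + b)`, in terms of the `2β`-component of `b`. -/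
theorem IsAxis.mul_mul_sub_smul_add (ha : IsAxis F (2 * β) β a) {l : F} {u v w : V}
    (hu : u ∈ eigSp F a 0) (hv : v ∈ eigSp F a (2 * β)) (hw : w ∈ eigSp F a β)
    (hb : b = l • a + u + v + w) :
    a * b - β • (a + b) = (l - β * l - β) • a - β • u + β • v ∧
      a * (a * b - β • (a + b)) = (l - β * l - β) • a + (2 * β ^ 2) • v := by
  rw [mem_eigSp] at hu hv hw
  have hs : a * b - β • (a + b) = (l - β * l - β) • a - β • u + β • v := by
    rw [hb]
    simp only [mul_add, mul_smul_comm, ha.idem, hu, hv, hw]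
    module
  refine ⟨hs, ?_⟩
  rw [hs]
  simp only [mul_add, mul_sub, mul_smul_comm, ha.idem, hu, hv]
  module

/-- For `b = l • a + u + v + w`, with `c = a₂` and `c' = a₋₂`, the `2β`-component of `c` is
`2 * zPoly β l m` times that of `b`. -/
theorem IsAxis.two_mul_component_eq (hchar : (2 : F) ≠ 0) (hβ0 : β ≠ 0) (hβhalf : 2 * β ≠ 1)
    (ha : IsAxis F (2 * β) β a) {τ : V ≃ₗ[F] V} (hτ : IsMiyamoto F (2 * β) β a τ)
    {l m n : F} {u v w u₂ v₂ w₂ c : V}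
    (hu : u ∈ eigSp F a 0) (hv : v ∈ eigSp F a (2 * β)) (hw : w ∈ eigSp F a β)
    (hb : b = l • a + u + v + w)
    (hu₂ : u₂ ∈ eigSp F a 0) (hv₂ : v₂ ∈ eigSp F a (2 * β)) (hw₂ : w₂ ∈ eigSp F a β)
    (hc : c = n • a + u₂ + v₂ + w₂)
    (hbs : (2 : F) • (b * (a * b - β • (a + b))) =
      (2 * (m - 2 * β * m - β + β ^ 2)) • b + (2 * β) • (a * b - β • (a + b)) +
        β ^ 2 • (a + c)) :
    v₂ = (2 * zPoly β l m) • v := by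
  obtain ⟨hs, has⟩ := ha.mul_mul_sub_smul_add hu hv hw hb
  generalize a * b - β • (a + b) = s at hs has hbs
  have hae : a ∈ eigSp F a 1 := by rw [mem_eigSp, ha.idem, one_smul]
  have hτs : τ s = s := by
    rw [hs]
    simp only [map_add, map_sub, map_smul, hτ.1 a hae, hτ.2.1 u hu, hτ.2.2.1 v hv]
  have hτb : τ b = l • a + u + v - w := by
    rw [hb]; exact hτ.apply_decomposition (Submodule.smul_mem _ _ hae) hu hv hw
  have hτc : τ c = n • a + u₂ + v₂ - w₂ := by
    rw [hc]; exact hτ.apply_decomposition (Submodule.smul_mem _ _ hae) hu₂ hv₂ hw₂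
  have hτbs := congrArg τ hbs
  simp only [map_add, map_smul, ha.miyamoto_map_mul hτ, hτ.1 a hae, hτs, hτb, hτc] at hτbs
  rw [hb, hc] at hbs
  have hsuv : (4 : F) • (s * (u + v)) =
      (4 * (m - 2 * β * m - β + β ^ 2)) • (l • a + u + v) + (4 * β) • s +
        (2 * β ^ 2) • (a + n • a + u₂ + v₂) - (4 * l) • (a * s) := by
    have hsum := congrArg₂ (· + ·) hbs hτbs
    simp only [add_mul, sub_mul, smul_mul_assoc, mul_comm u s, mul_comm v s,
      mul_comm w s] at hsum
    rw [mul_add]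
    linear_combination (norm := module) hsum
  have huv : a * (u * u - v * v) ∈ eigSp F a 1 := by
    have huu : a * (u * u) = 0 := by
      simpa [mem_eigSp] using ha.fusion00 u hu u hu
    obtain ⟨e, he, z, hz, hvv⟩ := Submodule.mem_sup.1 (ha.fusionaa v hv v hv)
    rw [mem_eigSp, zero_smul] at hz
    rw [mem_eigSp, one_smul] at he
    rw [← hvv, mul_sub, mul_add, huu, hz, he, mem_eigSp]
    simp [he]
  rw [ha.primitive, Submodule.mem_span_singleton] at huv
  obtain ⟨μ, hμ⟩ := huv
  have hsuv' : s * (u + v) = -β • (u * u - v * v) + (2 * β * (l - β * l - β)) • v := by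
    rw [mem_eigSp] at hu hv
    rw [hs]
    simp only [add_mul, sub_mul, mul_add, smul_mul_assoc, hu, hv, mul_comm v u]
    module
  have hasuv := congrArg (a * ·) hsuv
  rw [mem_eigSp] at hu hv hu₂ hv₂
  simp only [hsuv'] at hasuv
  generalize u * u - v * v = q at hμ hasuv
  simp only [hs, mul_add, mul_sub, mul_smul_comm, hu, hv, hu₂, hv₂, ha.idem, ← hμ] at hasuv
  have hZ : β ^ 2 * (2 * zPoly β l m) =
      4 * β * l + 2 * (2 * β - 1) * m - 2 * β * (4 * β - 1) := by
    rw [zPoly]; field_simp; ring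
  obtain ⟨κ, hκ⟩ : ∃ κ : F, v₂ - (2 * zPoly β l m) • v = κ • a := by
    refine ⟨(4 * β ^ 3)⁻¹ * (-4 * β * μ -
      4 * (m - 2 * β * m - β + β ^ 2) * l - 4 * β * (l - β * l - β)
      - 2 * β ^ 2 * (1 + n) + 4 * l * (l - β * l - β)), ?_⟩
    have h4 : 4 * β ^ 3 ≠ 0 := by
      have : (4 : F) = 2 * 2 := by norm_num
      simp [this, hchar, hβ0]
    rw [mul_smul (4 * β ^ 3)⁻¹, eq_inv_smul_iff₀ h4, smul_sub, smul_smul,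
      show 4 * β ^ 3 * (2 * zPoly β l m) = 4 * β * (β ^ 2 * (2 * zPoly β l m)) by ring, hZ]
    linear_combination (norm := module) -hasuv
  have hD : (2 * β - 1) • (v₂ - (2 * zPoly β l m) • v) = 0 := by
    have h1 : a * (v₂ - (2 * zPoly β l m) • v) = (2 * β) • (v₂ - (2 * zPoly β l m) • v) := by
      rw [mul_sub, mul_smul_comm, hv, hv₂]; module
    have h2 : a * (v₂ - (2 * zPoly β l m) • v) = v₂ - (2 * zPoly β l m) • v := by
      rw [hκ, mul_smul_comm, ha.idem]
    rw [sub_smul, ← h1, h2, one_smul, sub_self]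
  exact sub_eq_zero.1 ((smul_eq_zero_iff_right (sub_ne_zero.2 hβhalf)).1 hD)

end MonsterType

/-- The formula for `a₄` in a 2-generated primitive axial algebra of Monster type
`(2β, β)`. -/
theorem stmt7 (F : Type*) [Field F] (V : Type*) [NonUnitalNonAssocCommRing V]
    [Module F V] [SMulCommClass F V V] [IsScalarTower F V V]
    (β : F) (hchar : (2 : F) ≠ 0) (hβ0 : β ≠ 0) (hβ1 : β ≠ 1) (hβhalf : β ≠ 1 / 2)
    (a₀ a₁ : V) (ha₀ : IsAxis F (2 * β) β a₀) (ha₁ : IsAxis F (2 * β) β a₁)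
    (hgen : NonUnitalAlgebra.adjoin F {a₀, a₁} = ⊤)
    (τ₀ τ₁ : V ≃ₗ[F] V)
    (hτ₀ : IsMiyamoto F (2 * β) β a₀ τ₀) (hτ₁ : IsMiyamoto F (2 * β) β a₁ τ₁)
    (l1 l1f l2 : F)
    (hl1 : aSeq a₀ a₁ τ₀ τ₁ 1 - l1 • a₀ ∈
      eigSp F a₀ 0 ⊔ eigSp F a₀ (2 * β) ⊔ eigSp F a₀ β)
    (hl1f : aSeq a₀ a₁ τ₀ τ₁ 0 - l1f • a₁ ∈
      eigSp F a₁ 0 ⊔ eigSp F a₁ (2 * β) ⊔ eigSp F a₁ β)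
    (hl2 : aSeq a₀ a₁ τ₀ τ₁ 2 - l2 • a₀ ∈
      eigSp F a₀ 0 ⊔ eigSp F a₀ (2 * β) ⊔ eigSp F a₀ β) :
    aSeq a₀ a₁ τ₀ τ₁ 4 =
      aSeq a₀ a₁ τ₀ τ₁ (-2)
        - (2 * zPoly β l1 l1f) • (aSeq a₀ a₁ τ₀ τ₁ (-1) - aSeq a₀ a₁ τ₀ τ₁ 3)
        + (1 / β * (4 * zPoly β l1 l1f * (l1 - β) - (2 * l2 - β))) •
          (aSeq a₀ a₁ τ₀ τ₁ 0 - aSeq a₀ a₁ τ₀ τ₁ 2) := by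
  have h2β : 2 * β ≠ 1 := fun h ↦ hβhalf (by rw [eq_div_iff hchar, mul_comm, h])
  have i₀ := ha₀.miyamoto_apply_apply hτ₀
  have i₁ := ha₁.miyamoto_apply_apply hτ₁
  have f₀ := ha₀.miyamoto_apply_self hτ₀
  have f₁ := ha₁.miyamoto_apply_self hτ₁
  have hinv : (τ₁ * τ₀)⁻¹ = τ₀ * τ₁ := by
    rw [inv_eq_iff_mul_eq_one]
    ext x
    simp [LinearEquiv.mul_apply, i₀, i₁]
  have e₀ : aSeq a₀ a₁ τ₀ τ₁ 0 = a₀ := by simp [aSeq]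
  have e₁ : aSeq a₀ a₁ τ₀ τ₁ 1 = a₁ := by simp [aSeq]
  have e₂ : aSeq a₀ a₁ τ₀ τ₁ 2 = τ₁ a₀ := by simp [aSeq, LinearEquiv.mul_apply, f₀]
  have e₃ : aSeq a₀ a₁ τ₀ τ₁ 3 = τ₁ (τ₀ a₁) := by
    norm_num [aSeq, LinearEquiv.mul_apply]
  have e₄ : aSeq a₀ a₁ τ₀ τ₁ 4 = τ₁ (τ₀ (τ₁ a₀)) := by
    norm_num [aSeq, LinearEquiv.mul_apply, zpow_ofNat, pow_two, f₀]
  have en₁ : aSeq a₀ a₁ τ₀ τ₁ (-1) = τ₀ a₁ := by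
    norm_num [aSeq, hinv, LinearEquiv.mul_apply, f₁]
  have en₂ : aSeq a₀ a₁ τ₀ τ₁ (-2) = τ₀ (τ₁ a₀) := by
    norm_num [aSeq, hinv, LinearEquiv.mul_apply]
  rw [e₁] at hl1
  rw [e₀] at hl1f
  rw [e₂] at hl2
  rw [e₀, e₂, e₃, e₄, en₁, en₂]
  obtain ⟨u, hu, v, hv, w, hw, hb⟩ := exists_eigenvectors_of_sub_mem_sup hl1
  obtain ⟨u', hu', v', hv', w', hw', ha⟩ := exists_eigenvectors_of_sub_mem_sup hl1f
  obtain ⟨u₂, hu₂, v₂, hv₂, w₂, hw₂, hc⟩ := exists_eigenvectors_of_sub_mem_sup hl2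
  have hae₀ : a₀ ∈ eigSp F a₀ 1 := by rw [mem_eigSp, ha₀.idem, one_smul]
  have hae₁ : a₁ ∈ eigSp F a₁ 1 := by rw [mem_eigSp, ha₁.idem, one_smul]
  have t₁a : τ₁ a₀ = l1f • a₁ + u' + v' - w' := by
    nth_rw 1 [ha]
    exact hτ₁.apply_decomposition (Submodule.smul_mem _ _ hae₁) hu' hv' hw'
  have t₀b : τ₀ a₁ = l1 • a₀ + u + v - w := by
    nth_rw 1 [hb]
    exact hτ₀.apply_decomposition (Submodule.smul_mem _ _ hae₀) hu hv hw
  have t₀c : τ₀ (τ₁ a₀) = l2 • a₀ + u₂ + v₂ - w₂ := by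
    nth_rw 1 [hc]
    exact hτ₀.apply_decomposition (Submodule.smul_mem _ _ hae₀) hu₂ hv₂ hw₂
  obtain ⟨hs, -⟩ := ha₀.mul_mul_sub_smul_add hu hv hw hb
  obtain ⟨hs', hbs'⟩ := ha₁.mul_mul_sub_smul_add hu' hv' hw' ha
  obtain ⟨hs₂, -⟩ := ha₀.mul_mul_sub_smul_add hu₂ hv₂ hw₂ hc
  have hsymm : a₀ * a₁ - β • (a₀ + a₁) = a₁ * a₀ - β • (a₁ + a₀) := by
    rw [mul_comm, add_comm]
  have hbs : (2 : F) • (a₁ * (a₀ * a₁ - β • (a₀ + a₁))) =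
      (2 * (l1f - 2 * β * l1f - β + β ^ 2)) • a₁ + (2 * β) • (a₀ * a₁ - β • (a₀ + a₁)) +
        β ^ 2 • (a₀ + τ₁ a₀) := by
    rw [hsymm, hbs', hs', t₁a]
    linear_combination (norm := module) (-β ^ 2) • ha
  have hv₂v := ha₀.two_mul_component_eq hchar hβ0 h2β hτ₀ hu hv hw hb hu₂ hv₂ hw₂ hc hbs
  generalize zPoly β l1 l1f = Z at hv₂v ⊢
  have hs₂' : a₀ * τ₁ a₀ - β • (a₀ + τ₁ a₀) =
      (2 * Z) • (a₁ * a₀ - β • (a₁ + a₀)) - (β / 2) • (τ₁ a₀ + τ₀ (τ₁ a₀)) +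
        (β * Z) • (a₁ + τ₀ a₁) - (2 * Z * (l1 - β) - (l2 - β)) • a₀ := by
    rw [← hsymm, hs, hs₂, t₀b, t₀c]
    rw [hv₂v] at hc ⊢
    linear_combination (norm := skip) (β / 2) • hc - (β * Z) • hb
    match_scalars <;> field_simp <;> ring
  have hτs : τ₁ (a₁ * a₀ - β • (a₁ + a₀)) = a₁ * a₀ - β • (a₁ + a₀) := by
    rw [hs']
    simp only [map_add, map_sub, map_smul, f₁, hτ₁.2.1 u' hu', hτ₁.2.2.1 v' hv']
  have hs₂'' := congrArg τ₁ hs₂'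
  rw [map_sub τ₁ (a₀ * _), map_sub τ₁ (_ + _), map_add τ₁ (_ - _), map_sub τ₁ (_ • _)] at hs₂''
  simp only [map_add, map_smul, hτs, ha₁.miyamoto_map_mul hτ₁, i₁, f₁] at hs₂''
  have hcomm : τ₁ a₀ * a₀ = a₀ * τ₁ a₀ := mul_comm _ _
  linear_combination (norm := skip) (2 / β) • (hs₂'' - hs₂')
  rw [hcomm]
  match_scalars <;> field_simp <;> ring
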